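/- Consider the pure diffusion interface problem, i.e. γ = c = 0, with p ≥ 2. Let u ∈ W̃_β^{2p+1,∞} be an exact solution of −(βu′)′ = f on (a,α) ∪ (α,b) with u(a) = u(b) = 0, and let u_T ∈ U_T be an IFVM solution with the same data f. Then there exists a constant C, depending only on p, β⁻, β⁺ and b−a, such that: (i) |β(g_{i,j})(u′(g_{i,j}) − u_T′(g_{i,j}))| ≤ C h^{2p} ‖u‖_{2p+1,∞} at every generalized Gauss point g_{i,j}; (ii) |u(xᵢ) − u_T(xᵢ)| ≤ C h^{2p} ‖u‖_{2p+1,∞} at every mesh point xᵢ; and (iii) |(u − u_T)(xᵢ) − (u − u_T)(x_{i−1})| ≤ C h^{2p+1} ‖u‖_{2p+1,∞} for every i. -/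

import Mathlib

open Set

/-- The piecewise-constant diffusion coefficient with interface point `α`. -/
noncomputable def betaPW (βm βp α : ℝ) : ℝ → ℝ := fun t => if t < α then βm else βp

/-- Membership in the immersed trial space `U_T`: continuous on `[a,b]`, zero boundary
values, a polynomial of degree ≤ p on each non-interface element `[x_{i-1}, x_i]` (i ≠ k),
and on the interface element `[x_{k-1}, x_k]` a continuous piecewise polynomial of degree ≤ p
satisfying the derivative jump conditions at the interface `α`. -/
def MemUT (p N k : ℕ) (a b α βm βp : ℝ) (x : ℕ → ℝ) (v : ℝ → ℝ) : Prop :=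
  ContinuousOn v (Set.Icc a b) ∧ v a = 0 ∧ v b = 0 ∧
  (∀ i, 1 ≤ i → i ≤ N → i ≠ k → ∃ q : Polynomial ℝ, q.natDegree ≤ p ∧
    ∀ y ∈ Set.Icc (x (i - 1)) (x i), v y = q.eval y) ∧
  ∃ qm qp : Polynomial ℝ, qm.natDegree ≤ p ∧ qp.natDegree ≤ p ∧
    (∀ y ∈ Set.Icc (x (k - 1)) α, v y = qm.eval y) ∧
    (∀ y ∈ Set.Icc α (x k), v y = qp.eval y) ∧
    ∀ j, 1 ≤ j → j ≤ p →
      βm * ((⇑Polynomial.derivative)^[j] qm).eval α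
        = βp * ((⇑Polynomial.derivative)^[j] qp).eval α

/-- Membership in `W̃_β^{m,∞}`: continuous on `[a,b]`, zero boundary values, `C^m` on each
of `[a,α]` and `[α,b]`, and satisfying the flux jump conditions at `α` for `j = 1,…,m`. -/
def MemW (m : ℕ) (a b α βm βp : ℝ) (u : ℝ → ℝ) : Prop :=
  ContinuousOn u (Set.Icc a b) ∧ u a = 0 ∧ u b = 0 ∧
  ContDiffOn ℝ (m : ℕ∞) u (Set.Icc a α) ∧ ContDiffOn ℝ (m : ℕ∞) u (Set.Icc α b) ∧
  ∀ j, 1 ≤ j → j ≤ m →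
    βm * iteratedDerivWithin j u (Set.Icc a α) α
      = βp * iteratedDerivWithin j u (Set.Icc α b) α

/-- The broken `W^{m,∞}` norm `‖u‖_{m,∞}`: maximum of the piecewise `W^{m,∞}` norms on
`[a,α]` and `[α,b]`. -/
noncomputable def wnorm (m : ℕ) (a b α : ℝ) (u : ℝ → ℝ) : ℝ :=
  max (sSup {y : ℝ | ∃ j ≤ m, ∃ t ∈ Set.Icc a α,
        y = |iteratedDerivWithin j u (Set.Icc a α) t|})
      (sSup {y : ℝ | ∃ j ≤ m, ∃ t ∈ Set.Icc α b,
        y = |iteratedDerivWithin j u (Set.Icc α b) t|})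

/-- Every real polynomial has an antiderivative whose degree is larger by at most one. -/
lemma Polynomial.exists_derivative_eq (P : Polynomial ℝ) :
    ∃ Q : Polynomial ℝ, Q.natDegree ≤ P.natDegree + 1 ∧ Polynomial.derivative Q = P := by
  refine ⟨∑ i ∈ Finset.range (P.natDegree + 1),
    Polynomial.monomial (i + 1) (P.coeff i / ((i : ℝ) + 1)), ?_, ?_⟩
  · refine Polynomial.natDegree_sum_le_of_forall_le _ _ fun i hi => ?_
    have := Finset.mem_range.1 hi
    exact (Polynomial.natDegree_monomial_le _).trans (by omega)
  · rw [Polynomial.derivative_sum]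
    conv_rhs => rw [Polynomial.as_sum_range P]
    refine Finset.sum_congr rfl fun i _ => ?_
    have : (i : ℝ) + 1 ≠ 0 := by positivity
    rw [Polynomial.derivative_monomial]
    simp [this]

/-- Two real polynomials of degree at most `n` whose derivatives up to order `n` agree at a point
are equal. -/
lemma Polynomial.eq_of_iterate_derivative_eval_eq {n : ℕ} {P Q : Polynomial ℝ} {t : ℝ}
    (hP : P.natDegree ≤ n) (hQ : Q.natDegree ≤ n)
    (h : ∀ j ≤ n, ((⇑Polynomial.derivative)^[j] P).eval t
      = ((⇑Polynomial.derivative)^[j] Q).eval t) : P = Q := by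
  by_contra hne
  have h0 : P - Q ≠ 0 := sub_ne_zero.2 hne
  have h1 : n < (P - Q).rootMultiplicity t := by
    refine Polynomial.lt_rootMultiplicity_of_isRoot_iterate_derivative_of_mem_nonZeroDivisors h0
      (fun m hm => ?_) (mem_nonZeroDivisors_of_ne_zero (by positivity))
    rw [Polynomial.IsRoot, Polynomial.iterate_derivative_sub, Polynomial.eval_sub, h m hm, sub_self]
  have h2 : (P - Q).rootMultiplicity t ≤ (P - Q).natDegree := by
    rw [← Polynomial.count_roots]
    exact (Multiset.count_le_card _ _).trans (Polynomial.card_roots' _)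
  have h3 := Polynomial.natDegree_sub_le P Q
  have : max P.natDegree Q.natDegree ≤ n := max_le hP hQ
  omega

/-- Taylor approximation for a chain of successive right derivatives. -/
lemma exists_polynomial_approx_of_right_deriv (n : ℕ) {c d M : ℝ} (hM : 0 ≤ M) :
    ∀ W : ℕ → ℝ → ℝ, (∀ j ≤ n, ContinuousOn (W j) (Icc c d)) →
    (∀ j ≤ n, ∀ t ∈ Ico c d, HasDerivWithinAt (W j) (W (j + 1) t) (Ici t) t) →
    (∀ t ∈ Icc c d, |W (n + 1) t| ≤ M) →
    ∃ P : Polynomial ℝ, P.natDegree ≤ n ∧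
      ∀ t ∈ Icc c d, |W 0 t - P.eval t| ≤ M * (d - c) ^ (n + 1) := by
  induction n with
  | zero =>
    intro W hc hd hb
    refine ⟨Polynomial.C (W 0 c), by simp, fun t ht => ?_⟩
    have := norm_image_sub_le_of_norm_deriv_right_le_segment (hc 0 le_rfl) (hd 0 le_rfl)
      (fun x hx => hb x (Ico_subset_Icc_self hx)) t ht
    simp only [Polynomial.eval_C, zero_add, pow_one]
    refine this.trans ?_
    have := ht.2
    gcongr
  | succ n ih =>
    intro W hc hd hb
    obtain ⟨P, hPn, hP⟩ := ih (fun j => W (j + 1)) (fun j hj => hc _ (by omega))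
      (fun j hj => hd _ (by omega)) hb
    obtain ⟨Q, hQn, hQ⟩ := Polynomial.exists_derivative_eq P
    refine ⟨Q + Polynomial.C (W 0 c - Q.eval c), ?_, fun t ht => ?_⟩
    · rw [Polynomial.natDegree_add_C]
      omega
    have key := norm_image_sub_le_of_norm_deriv_right_le_segment (f := fun s => W 0 s - Q.eval s)
      (f' := fun s => W 1 s - P.eval s) (C := M * (d - c) ^ (n + 1))
      ((hc 0 (by omega)).sub Q.continuous.continuousOn)
      (fun x hx => (hd 0 (by omega) x hx).sub (hQ ▸ (Q.hasDerivAt x).hasDerivWithinAt))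
      (fun x hx => hP x (Ico_subset_Icc_self hx)) t ht
    have e : W 0 t - (Q + Polynomial.C (W 0 c - Q.eval c)).eval t
        = W 0 t - Q.eval t - (W 0 c - Q.eval c) := by
      simp only [Polynomial.eval_add, Polynomial.eval_C]
      ring
    rw [e]
    refine key.trans ?_
    have h0 : 0 ≤ d - c := sub_nonneg.2 (ht.1.trans ht.2)
    have := ht.2
    calc M * (d - c) ^ (n + 1) * (t - c) ≤ M * (d - c) ^ (n + 1) * (d - c) := by gcongr
      _ = _ := by ring

/-- Error of a positive quadrature rule, exact in degree `≤ m`, on a function whose values at the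
nodes differ by a constant from those of a polynomial. -/
lemma abs_integral_sub_le_of_quadrature {m : ℕ} {c d b₀ ε E : ℝ} {β w : ℝ → ℝ} {s : Finset ℕ}
    {g A : ℕ → ℝ} {P Q : Polynomial ℝ} (hcd : c ≤ d) (hb₀ : 0 < b₀) (hβ : ∀ t, b₀ ≤ β t)
    (hβi : IntervalIntegrable (fun t => (β t)⁻¹) MeasureTheory.volume c d)
    (hg : ∀ j ∈ s, g j ∈ Icc c d) (hA : ∀ j ∈ s, 0 < A j)
    (hquad : ∀ F : Polynomial ℝ, F.natDegree ≤ m →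
      ∑ j ∈ s, A j * F.eval (g j) = ∫ t in c..d, F.eval t / β t)
    (hw : ContinuousOn w (Icc c d)) (hP : P.natDegree ≤ m) (hQ : Q.natDegree ≤ m)
    (hwP : ∀ t ∈ Icc c d, |w t - P.eval t| ≤ ε)
    (hE : ∀ j ∈ s, w (g j) - Q.eval (g j) = E) :
    |(∫ t in c..d, w t / β t) - (∫ t in c..d, Q.eval t / β t) - E * ∫ t in c..d, (β t)⁻¹|
      ≤ 2 * ε * b₀⁻¹ * (d - c) := by
  have hint : ∀ {v : ℝ → ℝ}, ContinuousOn v (Icc c d) →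
      IntervalIntegrable (fun t => v t / β t) MeasureTheory.volume c d := fun {v} hv => by
    simp only [div_eq_mul_inv]
    exact hβi.continuousOn_mul (by rwa [uIcc_of_le hcd])
  have hε : 0 ≤ ε := (abs_nonneg _).trans (hwP c ⟨le_rfl, hcd⟩)
  have hβ0 : ∀ t, 0 < β t := fun t => hb₀.trans_le (hβ t)
  have hinv : ∀ t, |(β t)⁻¹| ≤ b₀⁻¹ := fun t => by
    rw [abs_of_pos (inv_pos.2 (hβ0 t))]
    exact inv_anti₀ hb₀ (hβ t)
  have hsub : (∫ t in c..d, (w t - P.eval t) / β t)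
      = (∫ t in c..d, w t / β t) - ∫ t in c..d, P.eval t / β t := by
    rw [← intervalIntegral.integral_sub (hint hw) (hint P.continuous.continuousOn)]
    simp only [sub_div]
  have hpoly : (∫ t in c..d, P.eval t / β t) - (∫ t in c..d, Q.eval t / β t)
      - E * (∫ t in c..d, (β t)⁻¹) = ∑ j ∈ s, A j * (P.eval (g j) - w (g j)) := by
    have hC := hquad (Polynomial.C E) (by simp)
    simp only [Polynomial.eval_C, div_eq_mul_inv E, intervalIntegral.integral_const_mul] at hC
    rw [← hquad P hP, ← hquad Q hQ, ← hC, ← Finset.sum_sub_distrib, ← Finset.sum_sub_distrib]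
    refine Finset.sum_congr rfl fun j hj => ?_
    rw [← hE j hj]
    ring
  have h1 : |∫ t in c..d, (w t - P.eval t) / β t| ≤ ε * b₀⁻¹ * (d - c) := by
    have := intervalIntegral.norm_integral_le_of_norm_le_const (a := c) (b := d)
      (f := fun t => (w t - P.eval t) / β t) (C := ε * b₀⁻¹) (fun t ht => by
        rw [uIoc_of_le hcd] at ht
        rw [div_eq_mul_inv, norm_mul]
        exact mul_le_mul (hwP t (Ioc_subset_Icc_self ht)) (hinv t) (norm_nonneg _) hε)
    rwa [abs_of_nonneg (sub_nonneg.2 hcd)] at this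
  have h2 : |∑ j ∈ s, A j * (P.eval (g j) - w (g j))| ≤ ε * b₀⁻¹ * (d - c) := by
    have hone := hquad 1 (by simp)
    simp only [Polynomial.eval_one, mul_one, one_div] at hone
    have hle : ∫ t in c..d, (β t)⁻¹ ≤ b₀⁻¹ * (d - c) := by
      have := intervalIntegral.norm_integral_le_of_norm_le_const (a := c) (b := d)
        (f := fun t => (β t)⁻¹) (fun t _ => hinv t)
      rw [abs_of_nonneg (sub_nonneg.2 hcd)] at this
      exact (le_abs_self _).trans this
    calc |∑ j ∈ s, A j * (P.eval (g j) - w (g j))|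
        ≤ ∑ j ∈ s, A j * ε := by
          refine (Finset.abs_sum_le_sum_abs _ _).trans (Finset.sum_le_sum fun j hj => ?_)
          rw [abs_mul, abs_of_pos (hA j hj), abs_sub_comm]
          exact mul_le_mul_of_nonneg_left (hwP _ (hg j hj)) (hA j hj).le
      _ = ε * ∫ t in c..d, (β t)⁻¹ := by rw [← Finset.sum_mul, hone, mul_comm]
      _ ≤ ε * (b₀⁻¹ * (d - c)) := by gcongr
      _ = _ := by ring
  have e : (∫ t in c..d, w t / β t) - (∫ t in c..d, Q.eval t / β t) - E * (∫ t in c..d, (β t)⁻¹)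
      = (∫ t in c..d, (w t - P.eval t) / β t) + ∑ j ∈ s, A j * (P.eval (g j) - w (g j)) := by
    rw [hsub, ← hpoly]
    ring
  rw [e]
  exact (abs_add_le _ _).trans (by linarith)

lemma betaPW_eventuallyEq_nhdsGE (βm βp α t : ℝ) :
    betaPW βm βp α =ᶠ[nhdsWithin t (Ici t)] fun _ => betaPW βm βp α t := by
  rcases lt_or_ge t α with h | h
  · filter_upwards [nhdsWithin_le_nhds (Iio_mem_nhds h)] with s hs
    simp only [betaPW, if_pos h, if_pos (mem_Iio.1 hs)]
  · filter_upwards [self_mem_nhdsWithin] with s hs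
    simp only [betaPW, if_neg h.not_gt, if_neg (h.trans hs).not_gt]

lemma min_le_betaPW (βm βp α t : ℝ) : min βm βp ≤ betaPW βm βp α t := by
  unfold betaPW
  split_ifs
  exacts [min_le_left _ _, min_le_right _ _]

lemma betaPW_le_max (βm βp α t : ℝ) : betaPW βm βp α t ≤ max βm βp := by
  unfold betaPW
  split_ifs
  exacts [le_max_left _ _, le_max_right _ _]

lemma intervalIntegrable_inv_betaPW {βm βp : ℝ} (α : ℝ) (hβm : 0 < βm) (hβp : 0 < βp) (c d : ℝ) :
    IntervalIntegrable (fun t => (betaPW βm βp α t)⁻¹) MeasureTheory.volume c d := by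
  have hmeas : Measurable (fun t => (betaPW βm βp α t)⁻¹) :=
    (Measurable.ite measurableSet_Iio measurable_const measurable_const).inv
  refine (intervalIntegrable_const (c := (min βm βp)⁻¹)).mono_fun hmeas.aestronglyMeasurable
    (Filter.Eventually.of_forall fun t => ?_)
  have h0 : 0 < min βm βp := lt_min hβm hβp
  have h1 := min_le_betaPW βm βp α t
  dsimp only
  rw [Real.norm_of_nonneg (inv_nonneg.2 (h0.le.trans h1)), Real.norm_of_nonneg (inv_nonneg.2 h0.le)]
  exact inv_anti₀ h0 h1

/-- The piecewise `j`-th derivative of a function that is smooth on both sides of `α`. -/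
noncomputable def brokenDeriv (a b α : ℝ) (u : ℝ → ℝ) (j : ℕ) (t : ℝ) : ℝ :=
  if t < α then iteratedDerivWithin j u (Icc a α) t else iteratedDerivWithin j u (Icc α b) t

lemma brokenDeriv_zero (a b α : ℝ) (u : ℝ → ℝ) : brokenDeriv a b α u 0 = u := by
  funext t
  simp [brokenDeriv]

lemma brokenDeriv_eventuallyEq_left (a b : ℝ) {α t : ℝ} (u : ℝ → ℝ) (j : ℕ) (h : t < α) :
    brokenDeriv a b α u j =ᶠ[nhds t] iteratedDerivWithin j u (Icc a α) := by
  filter_upwards [Iio_mem_nhds h] with s hs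
  exact if_pos hs

lemma ContDiffOn.hasDerivWithinAt_iteratedDerivWithin_Icc {m j : ℕ} {c d t : ℝ} {u : ℝ → ℝ}
    (hu : ContDiffOn ℝ (m : ℕ∞) u (Icc c d)) (hcd : c < d) (hj : j < m) (ht : t ∈ Icc c d) :
    HasDerivWithinAt (iteratedDerivWithin j u (Icc c d))
      (iteratedDerivWithin (j + 1) u (Icc c d) t) (Icc c d) t := by
  rw [iteratedDerivWithin_succ]
  exact (hu.differentiableOn_iteratedDerivWithin (by exact_mod_cast hj) (uniqueDiffOn_Icc hcd)
    t ht).hasDerivWithinAt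

section MemW

variable {m : ℕ} {a b α βm βp : ℝ} {u : ℝ → ℝ}

lemma MemW.hasDerivWithinAt_brokenDeriv (hu : MemW m a b α βm βp u) (haα : a < α) (hαb : α < b)
    {j : ℕ} (hj : j < m) {t : ℝ} (ht : t ∈ Ico a b) :
    HasDerivWithinAt (brokenDeriv a b α u j) (brokenDeriv a b α u (j + 1) t) (Ici t) t := by
  obtain ⟨-, -, -, hm, hp, -⟩ := hu
  rcases lt_or_ge t α with h | h
  · have h1 := (hm.hasDerivWithinAt_iteratedDerivWithin_Icc haα hj
      ⟨ht.1, h.le⟩).mono_of_mem_nhdsWithin (Icc_mem_nhdsGE_of_mem ⟨ht.1, h⟩)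
    rw [brokenDeriv, if_pos h]
    exact h1.congr_of_eventuallyEq
      (nhdsWithin_le_nhds (brokenDeriv_eventuallyEq_left a b u j h)) (if_pos h)
  · have h1 := (hp.hasDerivWithinAt_iteratedDerivWithin_Icc hαb hj
      ⟨h, ht.2.le⟩).mono_of_mem_nhdsWithin (Icc_mem_nhdsGE_of_mem ⟨h, ht.2⟩)
    rw [brokenDeriv, if_neg h.not_gt]
    refine h1.congr_of_eventuallyEq ?_ (if_neg h.not_gt)
    filter_upwards [self_mem_nhdsWithin] with s hs
    exact if_neg (h.trans hs).not_gt

lemma MemW.hasDerivAt_brokenDeriv (hu : MemW m a b α βm βp u)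
    {j : ℕ} (hj : j < m) {t : ℝ} (ht : t ∈ Ioo a α ∪ Ioo α b) :
    HasDerivAt (brokenDeriv a b α u j) (brokenDeriv a b α u (j + 1) t) t := by
  obtain ⟨-, -, -, hm, hp, -⟩ := hu
  rcases ht with h | h
  · have h1 := (hm.hasDerivWithinAt_iteratedDerivWithin_Icc (h.1.trans h.2) hj
      (Ioo_subset_Icc_self h)).hasDerivAt (Icc_mem_nhds h.1 h.2)
    rw [brokenDeriv, if_pos h.2]
    exact h1.congr_of_eventuallyEq (brokenDeriv_eventuallyEq_left a b u j h.2)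
  · have h1 := (hp.hasDerivWithinAt_iteratedDerivWithin_Icc (h.1.trans h.2) hj
      (Ioo_subset_Icc_self h)).hasDerivAt (Icc_mem_nhds h.1 h.2)
    rw [brokenDeriv, if_neg h.1.not_gt]
    refine h1.congr_of_eventuallyEq ?_
    filter_upwards [Ioi_mem_nhds h.1] with s hs
    exact if_neg (mem_Ioi.1 hs).not_gt

lemma MemW.deriv_eq (hu : MemW m a b α βm βp u) (hm : 0 < m) {t : ℝ}
    (ht : t ∈ Ioo a α ∪ Ioo α b) : deriv u t = brokenDeriv a b α u 1 t := by
  have := (hu.hasDerivAt_brokenDeriv hm ht).deriv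
  rwa [brokenDeriv_zero] at this

lemma MemW.iteratedDeriv_two_eq (hu : MemW m a b α βm βp u) (hm : 1 < m) {t : ℝ}
    (ht : t ∈ Ioo a α ∪ Ioo α b) : iteratedDeriv 2 u t = brokenDeriv a b α u 2 t := by
  have h : deriv u =ᶠ[nhds t] brokenDeriv a b α u 1 := by
    filter_upwards [(isOpen_Ioo.union isOpen_Ioo).mem_nhds ht] with s hs
    exact hu.deriv_eq (by omega) hs
  rw [iteratedDeriv_succ, iteratedDeriv_one, h.deriv_eq]
  exact (hu.hasDerivAt_brokenDeriv hm ht).deriv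

lemma MemW.hasDerivWithinAt_flux (hu : MemW m a b α βm βp u) (haα : a < α) (hαb : α < b)
    {j : ℕ} (hj : j < m) {t : ℝ} (ht : t ∈ Ico a b) :
    HasDerivWithinAt (fun s => betaPW βm βp α s * brokenDeriv a b α u j s)
      (betaPW βm βp α t * brokenDeriv a b α u (j + 1) t) (Ici t) t := by
  refine ((hu.hasDerivWithinAt_brokenDeriv haα hαb hj ht).const_mul
    (betaPW βm βp α t)).congr_of_eventuallyEq ?_ rfl
  filter_upwards [betaPW_eventuallyEq_nhdsGE βm βp α t] with s hs
  rw [hs]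

lemma MemW.continuousOn_flux (hu : MemW m a b α βm βp u) (haα : a < α) (hαb : α < b)
    {j : ℕ} (hj1 : 1 ≤ j) (hj : j ≤ m) :
    ContinuousOn (fun s => betaPW βm βp α s * brokenDeriv a b α u j s) (Icc a b) := by
  obtain ⟨-, -, -, hm, hp, hjump⟩ := hu
  rw [← Icc_union_Icc_eq_Icc haα.le hαb.le]
  refine ContinuousOn.union_of_isClosed ?_ ?_ isClosed_Icc isClosed_Icc
  · refine ((hm.continuousOn_iteratedDerivWithin (m := j) (by exact_mod_cast hj)
      (uniqueDiffOn_Icc haα)).const_mul βm).congr fun t ht => ?_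
    rcases ht.2.lt_or_eq with h | rfl
    · simp only [betaPW, brokenDeriv, if_pos h]
    · simpa only [betaPW, brokenDeriv, lt_irrefl, if_false] using (hjump j hj1 hj).symm
  · refine ((hp.continuousOn_iteratedDerivWithin (m := j) (by exact_mod_cast hj)
      (uniqueDiffOn_Icc hαb)).const_mul βp).congr fun t ht => ?_
    simp only [betaPW, brokenDeriv, if_neg ht.1.not_gt]

lemma ContDiffOn.abs_iteratedDerivWithin_le_sSup {c d : ℝ}
    (hu : ContDiffOn ℝ (m : ℕ∞) u (Icc c d)) (hcd : c < d) {j : ℕ} (hj : j ≤ m) {t : ℝ}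
    (ht : t ∈ Icc c d) :
    |iteratedDerivWithin j u (Icc c d) t| ≤ sSup {y : ℝ | ∃ j ≤ m, ∃ t ∈ Icc c d,
      y = |iteratedDerivWithin j u (Icc c d) t|} := by
  refine le_csSup ?_ ⟨j, hj, t, ht, rfl⟩
  have hB : ∀ i ≤ m, ∃ B, ∀ s ∈ Icc c d, ‖iteratedDerivWithin i u (Icc c d) s‖ ≤ B :=
    fun i hi => isCompact_Icc.exists_bound_of_continuousOn
      (hu.continuousOn_iteratedDerivWithin (by exact_mod_cast hi) (uniqueDiffOn_Icc hcd))
  choose! B hB using hB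
  refine ⟨∑ i ∈ Finset.range (m + 1), |B i|, ?_⟩
  rintro _ ⟨i, hi, s, hs, rfl⟩
  exact ((hB i hi s hs).trans (le_abs_self _)).trans
    (Finset.single_le_sum (f := fun i => |B i|) (fun _ _ => abs_nonneg _)
      (Finset.mem_range.2 (by omega)))

lemma MemW.abs_brokenDeriv_le (hu : MemW m a b α βm βp u) (haα : a < α) (hαb : α < b)
    {j : ℕ} (hj : j ≤ m) {t : ℝ} (ht : t ∈ Icc a b) :
    |brokenDeriv a b α u j t| ≤ wnorm m a b α u := by
  obtain ⟨-, -, -, hm, hp, -⟩ := hu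
  rcases lt_or_ge t α with h | h
  · rw [brokenDeriv, if_pos h]
    exact (hm.abs_iteratedDerivWithin_le_sSup haα hj ⟨ht.1, h.le⟩).trans (le_max_left _ _)
  · rw [brokenDeriv, if_neg h.not_gt]
    exact (hp.abs_iteratedDerivWithin_le_sSup hαb hj ⟨h, ht.2⟩).trans (le_max_right _ _)

/-- The increments of the flux of an exact solution are integrals of the data. -/
lemma MemW.integral_data_eq (hu : MemW m a b α βm βp u) (hm : 2 ≤ m) (haα : a < α) (hαb : α < b)
    {f : ℝ → ℝ} (hf : ∀ t, t ∈ Ioo a α ∪ Ioo α b →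
      -(betaPW βm βp α t * iteratedDeriv 2 u t) = f t)
    {c d : ℝ} (hc : c ∈ Ioo a b) (hd : d ∈ Ioo a b) :
    ∫ t in c..d, f t = betaPW βm βp α c * brokenDeriv a b α u 1 c
      - betaPW βm βp α d * brokenDeriv a b α u 1 d := by
  have hsub : uIcc c d ⊆ Ioo a b := ordConnected_Ioo.uIcc_subset hc hd
  have hcont : ∀ {j : ℕ}, 1 ≤ j → j ≤ m →
      ContinuousOn (fun s => betaPW βm βp α s * brokenDeriv a b α u j s) (uIcc c d) :=
    fun h1 h2 => (hu.continuousOn_flux haα hαb h1 h2).mono (hsub.trans Ioo_subset_Icc_self)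
  have h := intervalIntegral.integral_eq_sub_of_hasDeriv_right (hcont (le_refl 1) (by omega))
    (fun t ht => (hu.hasDerivWithinAt_flux haα hαb (j := 1) (by omega)
      (Ioo_subset_Ico_self (hsub (Ioo_subset_Icc_self ht)))).mono Ioi_subset_Ici_self)
    (hcont (j := 2) (by omega) hm).intervalIntegrable
  rw [← neg_sub, ← h, ← intervalIntegral.integral_neg]
  refine intervalIntegral.integral_congr_ae ?_
  filter_upwards [MeasureTheory.Measure.ae_ne MeasureTheory.volume α] with t hne ht
  have ht' : t ∈ Ioo a b := hsub (uIoc_subset_uIcc ht)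
  have ht2 : t ∈ Ioo a α ∪ Ioo α b :=
    hne.lt_or_gt.imp (fun h => ⟨ht'.1, h⟩) (fun h => ⟨h, ht'.2⟩)
  rw [← hf t ht2, hu.iteratedDeriv_two_eq (by omega) ht2]

end MemW

/-- On every element, the flux of a trial function is a polynomial of degree less than `p`. -/
lemma MemUT.exists_flux_polynomial {p N k : ℕ} {a b α βm βp : ℝ} {x : ℕ → ℝ} {v : ℝ → ℝ}
    (hp : 1 ≤ p) (hv : MemUT p N k a b α βm βp x v) (hβm : 0 < βm) (hβp : 0 < βp)
    (hx : ∀ i j, i ≤ j → j ≤ N → x i ≤ x j) (hk1 : 1 ≤ k) (hkN : k ≤ N)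
    (hαl : x (k - 1) < α) (hαr : α < x k) {i : ℕ} (hi1 : 1 ≤ i) (hiN : i ≤ N) :
    ∃ Q : Polynomial ℝ, Q.natDegree ≤ p - 1 ∧
      (∀ t ∈ Ico (x (i - 1)) (x i),
        HasDerivWithinAt v (Q.eval t / betaPW βm βp α t) (Ici t) t) ∧
      ∀ t ∈ Ioo (x (i - 1)) (x i), t ≠ α → betaPW βm βp α t * deriv v t = Q.eval t := by
  obtain ⟨-, -, -, hne, qm, qp, hqm, hqp, hvm, hvp, hjump⟩ := hv
  have hright : ∀ {q : Polynomial ℝ} {c d t : ℝ}, (∀ y ∈ Icc c d, v y = q.eval y) →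
      t ∈ Ico c d → HasDerivWithinAt v (q.derivative.eval t) (Ici t) t := by
    intro q c d t hq ht
    refine (q.hasDerivAt t).hasDerivWithinAt.congr_of_eventuallyEq ?_
      (hq t (Ico_subset_Icc_self ht))
    filter_upwards [Icc_mem_nhdsGE_of_mem ht] with s hs using hq s hs
  have hderiv : ∀ {q : Polynomial ℝ} {c d t : ℝ}, (∀ y ∈ Icc c d, v y = q.eval y) →
      t ∈ Ioo c d → deriv v t = q.derivative.eval t := by
    intro q c d t hq ht
    refine ((q.hasDerivAt t).congr_of_eventuallyEq ?_).deriv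
    filter_upwards [Icc_mem_nhds ht.1 ht.2] with s hs using hq s hs
  have hdeg : ∀ {q : Polynomial ℝ} (r : ℝ), q.natDegree ≤ p →
      (Polynomial.C r * q.derivative).natDegree ≤ p - 1 := fun {q} r hq =>
    (Polynomial.natDegree_C_mul_le _ _).trans
      (q.natDegree_derivative_le.trans (Nat.sub_le_sub_right hq 1))
  by_cases hik : i = k
  · subst hik
    have hQ : Polynomial.C βm * qm.derivative = Polynomial.C βp * qp.derivative := by
      refine Polynomial.eq_of_iterate_derivative_eval_eq (t := α) (hdeg _ hqm) (hdeg _ hqp)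
        fun j hj => ?_
      have := hjump (j + 1) (by omega) (by omega)
      simpa only [Polynomial.iterate_derivative_C_mul, Polynomial.eval_mul, Polynomial.eval_C,
        Function.iterate_succ_apply] using this
    refine ⟨Polynomial.C βm * qm.derivative, hdeg _ hqm, fun t ht => ?_, fun t ht hne => ?_⟩
    · rcases lt_or_ge t α with h | h
      · convert hright hvm ⟨ht.1, h⟩ using 1
        simp [betaPW, h, hβm.ne']
      · rw [hQ]
        convert hright hvp ⟨h, ht.2⟩ using 1
        simp [betaPW, h.not_gt, hβp.ne']
    · rcases hne.lt_or_gt with h | h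
      · rw [hderiv hvm ⟨ht.1, h⟩]
        simp [betaPW, h]
      · rw [hQ, hderiv hvp ⟨h, ht.2⟩]
        simp [betaPW, h.not_gt]
  · obtain ⟨q, hq, hvq⟩ := hne i hi1 hiN hik
    obtain ⟨r, hr, hβr⟩ : ∃ r : ℝ, 0 < r ∧
        ∀ t ∈ Ico (x (i - 1)) (x i), betaPW βm βp α t = r := by
      rcases Nat.lt_or_gt_of_ne hik with h | h
      · refine ⟨βm, hβm, fun t ht => if_pos ?_⟩
        have := hx i (k - 1) (by omega) (by omega)
        linarith [ht.2]
      · refine ⟨βp, hβp, fun t ht => if_neg (not_lt.2 ?_)⟩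
        have := hx k (i - 1) (by omega) (by omega)
        linarith [ht.1]
    refine ⟨Polynomial.C r * q.derivative, hdeg _ hq, fun t ht => ?_, fun t ht _ => ?_⟩
    · convert hright hvq ht using 1
      simp [hβr t ht, hr.ne']
    · rw [hderiv hvq ht, hβr t (Ioo_subset_Ico_self ht)]
      simp

/-- If the increments of a grid function vanishing at both ends agree, up to `K` times the mesh
width, with those of a multiple of `∫ β⁻¹`, then both the multiple and the grid function are
controlled by `K`. -/
lemma nodal_bounds_of_increments {N : ℕ} {x e : ℕ → ℝ} {b₀ B K E : ℝ} {β : ℝ → ℝ}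
    (hb₀ : 0 < b₀) (hβ : ∀ t, b₀ ≤ β t) (hβB : ∀ t, β t ≤ B)
    (hβi : ∀ c d, IntervalIntegrable (fun t => (β t)⁻¹) MeasureTheory.volume c d)
    (hK : 0 ≤ K) (hx : ∀ i j, i ≤ j → j ≤ N → x i ≤ x j) (hx0 : x 0 < x N)
    (he0 : e 0 = 0) (heN : e N = 0)
    (hE : ∀ i, 1 ≤ i → i ≤ N →
      |e i - e (i - 1) - E * ∫ t in (x (i - 1))..(x i), (β t)⁻¹| ≤ K * (x i - x (i - 1))) :
    |E| ≤ K * B ∧ (∀ i ≤ N, |e i| ≤ K * (1 + B * b₀⁻¹) * (x N - x 0)) ∧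
    ∀ i, 1 ≤ i → i ≤ N → |e i - e (i - 1)| ≤ K * (1 + B * b₀⁻¹) * (x i - x (i - 1)) := by
  have hβ0 : ∀ t, 0 < β t := fun t => hb₀.trans_le (hβ t)
  have hB : 0 < B := (hβ0 0).trans_le (hβB 0)
  have hI : ∀ {c d : ℝ}, c ≤ d → |∫ t in c..d, (β t)⁻¹| ≤ b₀⁻¹ * (d - c) := fun {c d} hcd => by
    have := intervalIntegral.norm_integral_le_of_norm_le_const (a := c) (b := d)
      (f := fun t => (β t)⁻¹) (C := b₀⁻¹) (fun t _ => by
        rw [Real.norm_of_nonneg (inv_pos.2 (hβ0 t)).le]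
        exact inv_anti₀ hb₀ (hβ t))
    rwa [abs_of_nonneg (sub_nonneg.2 hcd)] at this
  have hsum : ∀ i ≤ N, |e i - E * ∫ t in (x 0)..(x i), (β t)⁻¹| ≤ K * (x i - x 0) := by
    intro i
    induction i with
    | zero => simp [he0]
    | succ i ih =>
      intro hi
      have h1 := ih (by omega)
      have h2 := hE (i + 1) (by omega) hi
      rw [Nat.add_sub_cancel] at h2
      rw [← intervalIntegral.integral_add_adjacent_intervals (hβi (x 0) (x i)) (hβi _ _)]
      calc _ = |(e i - E * ∫ t in (x 0)..(x i), (β t)⁻¹)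
            + (e (i + 1) - e i - E * ∫ t in (x i)..(x (i + 1)), (β t)⁻¹)| := by ring_nf
        _ ≤ K * (x i - x 0) + K * (x (i + 1) - x i) := (abs_add_le _ _).trans (add_le_add h1 h2)
        _ = _ := by ring
  have hEB : |E| ≤ K * B := by
    have h1 := hsum N le_rfl
    rw [heN, zero_sub, abs_neg, abs_mul] at h1
    have h2 : B⁻¹ * (x N - x 0) ≤ |∫ t in (x 0)..(x N), (β t)⁻¹| := by
      refine le_trans ?_ (le_abs_self _)
      have := intervalIntegral.integral_mono_on hx0.le
        (intervalIntegrable_const (c := B⁻¹) (μ := MeasureTheory.volume)) (hβi (x 0) (x N))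
        (fun t _ => inv_anti₀ (hβ0 t) (hβB t))
      rwa [intervalIntegral.integral_const, smul_eq_mul, mul_comm] at this
    have h3 : |E| * B⁻¹ * (x N - x 0) ≤ K * (x N - x 0) := by
      rw [mul_assoc]
      exact (mul_le_mul_of_nonneg_left h2 (abs_nonneg _)).trans h1
    have h4 := le_of_mul_le_mul_right h3 (sub_pos.2 hx0)
    rwa [← div_eq_mul_inv, div_le_iff₀ hB] at h4
  have hcomb : ∀ {s c d : ℝ}, c ≤ d → |s - E * ∫ t in c..d, (β t)⁻¹| ≤ K * (d - c) →
      |s| ≤ K * (1 + B * b₀⁻¹) * (d - c) := by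
    intro s c d hcd hs
    have h1 : |E * ∫ t in c..d, (β t)⁻¹| ≤ K * B * (b₀⁻¹ * (d - c)) := by
      rw [abs_mul]
      exact mul_le_mul hEB (hI hcd) (abs_nonneg _) (by positivity)
    have h2 := abs_add_le (s - E * ∫ t in c..d, (β t)⁻¹) (E * ∫ t in c..d, (β t)⁻¹)
    rw [sub_add_cancel] at h2
    linarith
  refine ⟨hEB, fun i hi => ?_, fun i hi1 hi => hcomb (hx _ _ (by omega) hi) (hE i hi1 hi)⟩
  refine (hcomb (hx 0 i (by omega) hi) (hsum i hi)).trans ?_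
  have := hx i N hi le_rfl
  gcongr

/-- for the pure diffusion interface problem (`γ = c = 0`) with `p ≥ 2`, there
is a constant `C`, depending only on `p`, `β⁻`, `β⁺` and `b−a`, such that: (i) the flux error
at every generalized Gauss point is `≤ C h^{2p} ‖u‖_{2p+1,∞}`; (ii) the solution error at
every mesh point is `≤ C h^{2p} ‖u‖_{2p+1,∞}`; (iii) consecutive nodal error differences
are `≤ C h^{2p+1} ‖u‖_{2p+1,∞}`. -/
theorem stmt_18 (p : ℕ) (hp : 2 ≤ p) (βm βp d : ℝ)
    (hβm : 0 < βm) (hβp : 0 < βp) (hd : 0 < d) :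
    ∃ C : ℝ, 0 < C ∧
    (∀ (N k : ℕ) (a b α hm : ℝ) (x : ℕ → ℝ) (g A : ℕ → ℕ → ℝ),
    b - a = d →
    1 ≤ N →
    1 ≤ k →
    k ≤ N →
    a < b →
    x 0 = a →
    x N = b →
    (∀ i, i < N → x i < x (i + 1)) →
    x (k - 1) < α →
    α < x k →
    (∀ i ∈ Finset.Icc 1 N, ∀ j ∈ Finset.Icc 1 p,
      x (i - 1) < g i j ∧ g i j < x i ∧ g i j ≠ α) →
    (∀ i ∈ Finset.Icc 1 N, ∀ j, 1 ≤ j → j < p → g i j < g i (j + 1)) →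
    (∀ i, 1 ≤ i → i < N → g i (p + 1) = g (i + 1) 1) →
    (∀ i ∈ Finset.Icc 1 N, ∀ j ∈ Finset.Icc 1 p, 0 < A i j) →
    (∀ i ∈ Finset.Icc 1 N, ∀ F : Polynomial ℝ, F.natDegree ≤ 2 * p - 1 →
      ∑ j ∈ Finset.Icc 1 p, A i j * F.eval (g i j)
        = ∫ t in (x (i - 1))..(x i), F.eval t / betaPW βm βp α t) →
    (∀ i ∈ Finset.Icc 1 N, x i - x (i - 1) ≤ hm) →
    ∀ (f u uT : ℝ → ℝ),
    ContinuousOn f (Set.Ioo a α ∪ Set.Ioo α b) →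
    (∃ Mf : ℝ, ∀ t ∈ Set.Icc a b, |f t| ≤ Mf) →
    MemW (2 * p + 1) a b α βm βp u →
    (∀ t, t ∈ Set.Ioo a α ∪ Set.Ioo α b →
      -(betaPW βm βp α t * iteratedDeriv 2 u t) = f t) →
    MemUT p N k a b α βm βp x uT →
    (∀ i, 1 ≤ i → i ≤ N → ∀ j, 1 ≤ j → j ≤ (if i < N then p else p - 1) →
      betaPW βm βp α (g i j) * deriv uT (g i j)
        - betaPW βm βp α (g i (j + 1)) * deriv uT (g i (j + 1))
        = ∫ t in (g i j)..(g i (j + 1)), f t) →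
    (∀ i ∈ Finset.Icc 1 N, ∀ j ∈ Finset.Icc 1 p,
      |betaPW βm βp α (g i j) * (deriv u (g i j) - deriv uT (g i j))|
        ≤ C * hm ^ (2 * p) * wnorm (2 * p + 1) a b α u) ∧
    (∀ i ≤ N, |u (x i) - uT (x i)| ≤ C * hm ^ (2 * p) * wnorm (2 * p + 1) a b α u) ∧
    (∀ i ∈ Finset.Icc 1 N,
      |(u (x i) - uT (x i)) - (u (x (i - 1)) - uT (x (i - 1)))|
        ≤ C * hm ^ (2 * p + 1) * wnorm (2 * p + 1) a b α u)) := by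
  set b₀ := min βm βp
  set B := max βm βp
  have hb₀pos : 0 < b₀ := lt_min hβm hβp
  have hBpos : 0 < B := hβm.trans_le (le_max_left _ _)
  refine ⟨2 * B * b₀⁻¹ * (B + (1 + B * b₀⁻¹) * (d + 1)), by positivity, ?_⟩
  intro N k a b α hm x g A hd' hN hk1 hkN hab hx0 hxN hxs hαl hαr hg hgmono hgnext hA hquad hh
    f u uT _ _ hu hf huT hsol
  have hx : ∀ i j, i ≤ j → j ≤ N → x i ≤ x j := by
    intro i j hij
    induction j, hij using Nat.le_induction with
    | base => exact fun _ => le_rfl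
    | succ j hj ih => exact fun hjN => (ih (by omega)).trans (hxs j (by omega)).le
  have hax : ∀ i ≤ N, a ≤ x i := fun i hi => hx0 ▸ hx 0 i (by omega) hi
  have hxb : ∀ i ≤ N, x i ≤ b := fun i hi => hxN ▸ hx i N hi le_rfl
  have haα : a < α := (hax (k - 1) (by omega)).trans_lt hαl
  have hαb : α < b := hαr.trans_le (hxb k hkN)
  have hsub : ∀ i ∈ Finset.Icc 1 N, Icc (x (i - 1)) (x i) ⊆ Icc a b := fun i hi => by
    rw [Finset.mem_Icc] at hi
    exact Icc_subset_Icc (hax _ (by omega)) (hxb _ hi.2)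
  have hgab : ∀ i ∈ Finset.Icc 1 N, ∀ j ∈ Finset.Icc 1 p, g i j ∈ Ioo a b := fun i hi j hj => by
    have h := hg i hi j hj
    rw [Finset.mem_Icc] at hi
    exact ⟨(hax _ (by omega)).trans_lt h.1, h.2.1.trans_le (hxb _ hi.2)⟩
  have hgα : ∀ i ∈ Finset.Icc 1 N, ∀ j ∈ Finset.Icc 1 p, g i j ∈ Ioo a α ∪ Ioo α b :=
    fun i hi j hj => (hg i hi j hj).2.2.lt_or_gt.imp
      (fun h => ⟨(hgab i hi j hj).1, h⟩) (fun h => ⟨h, (hgab i hi j hj).2⟩)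
  have hhm : 0 ≤ hm := by
    have h1 := hh 1 (Finset.mem_Icc.2 ⟨le_rfl, hN⟩)
    have h2 := hx 0 1 (by omega) hN
    rw [Nat.sub_self] at h1
    linarith
  set M := wnorm (2 * p + 1) a b α u
  have hM0 : 0 ≤ M := (abs_nonneg _).trans
    (hu.abs_brokenDeriv_le haα hαb (j := 0) (by omega) (left_mem_Icc.2 hab.le))
  let w : ℕ → ℝ → ℝ := fun j t => betaPW βm βp α t * brokenDeriv a b α u (j + 1) t
  have hβ0 : ∀ t, 0 < betaPW βm βp α t := fun t => hb₀pos.trans_le (min_le_betaPW βm βp α t)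
  have hβi := intervalIntegrable_inv_betaPW α hβm hβp
  -- the flux error takes the same value at all Gauss points
  let ε : ℕ → ℕ → ℝ := fun i j =>
    betaPW βm βp α (g i j) * (deriv u (g i j) - deriv uT (g i j))
  have hstep : ∀ {i j i' j'}, i ∈ Finset.Icc 1 N → j ∈ Finset.Icc 1 p → i' ∈ Finset.Icc 1 N →
      j' ∈ Finset.Icc 1 p → betaPW βm βp α (g i j) * deriv uT (g i j)
        - betaPW βm βp α (g i' j') * deriv uT (g i' j') = ∫ t in (g i j)..(g i' j'), f t →
      ε i' j' = ε i j := by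
    intro i j i' j' hi hj hi' hj' h
    rw [hu.integral_data_eq (by omega) haα hαb hf (hgab i hi j hj) (hgab i' hi' j' hj'),
      ← hu.deriv_eq (by omega) (hgα i hi j hj), ← hu.deriv_eq (by omega) (hgα i' hi' j' hj')] at h
    simp only [ε]
    linarith
  have hrow : ∀ i ∈ Finset.Icc 1 N, ∀ j, 1 ≤ j → j ≤ p → ε i j = ε i 1 := by
    intro i hi j hj
    have hi' := Finset.mem_Icc.1 hi
    induction j, hj using Nat.le_induction with
    | base => exact fun _ => rfl
    | succ j hj ih =>
      intro hjp
      rw [← ih (by omega)]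
      exact hstep hi (Finset.mem_Icc.2 ⟨hj, by omega⟩) hi (Finset.mem_Icc.2 ⟨by omega, hjp⟩)
        (hsol i hi'.1 hi'.2 j hj (by split_ifs <;> omega))
  have hcol : ∀ i, 1 ≤ i → i ≤ N → ε i 1 = ε 1 1 := by
    intro i hi
    induction i, hi using Nat.le_induction with
    | base => exact fun _ => rfl
    | succ i hi ih =>
      intro hiN
      have hi' : i ∈ Finset.Icc 1 N := Finset.mem_Icc.2 ⟨hi, by omega⟩
      rw [← ih (by omega), ← hrow i hi' p (by omega) le_rfl]
      have h := hsol i hi (by omega) p (by omega) (by rw [if_pos (by omega)])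
      rw [hgnext i hi (by omega)] at h
      exact hstep hi' (Finset.mem_Icc.2 ⟨by omega, le_rfl⟩) (Finset.mem_Icc.2 ⟨by omega, hiN⟩)
        (Finset.mem_Icc.2 ⟨le_rfl, by omega⟩) h
  have hconst : ∀ i ∈ Finset.Icc 1 N, ∀ j ∈ Finset.Icc 1 p, ε i j = ε 1 1 := fun i hi j hj => by
    rw [hrow i hi j (Finset.mem_Icc.1 hj).1 (Finset.mem_Icc.1 hj).2,
      hcol i (Finset.mem_Icc.1 hi).1 (Finset.mem_Icc.1 hi).2]
  -- the increments of the nodal error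
  set K := 2 * (B * M * hm ^ (2 * p)) * b₀⁻¹ with hK
  have hinc : ∀ i, 1 ≤ i → i ≤ N → |(u (x i) - uT (x i)) - (u (x (i - 1)) - uT (x (i - 1)))
      - ε 1 1 * ∫ t in (x (i - 1))..(x i), (betaPW βm βp α t)⁻¹| ≤ K * (x i - x (i - 1)) := by
    intro i hi1 hiN
    have hi : i ∈ Finset.Icc 1 N := Finset.mem_Icc.2 ⟨hi1, hiN⟩
    have hle : x (i - 1) ≤ x i := hx _ _ (by omega) hiN
    have hico : Ico (x (i - 1)) (x i) ⊆ Ico a b :=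
      Ico_subset_Ico (hax _ (by omega)) (hxb _ hiN)
    obtain ⟨Q, hQdeg, hQr, hQd⟩ :=
      huT.exists_flux_polynomial (by omega) hβm hβp hx hk1 hkN hαl hαr hi1 hiN
    obtain ⟨P, hPdeg, hP⟩ := exists_polynomial_approx_of_right_deriv (2 * p - 1)
      (c := x (i - 1)) (d := x i) (M := B * M) (by positivity) w
      (fun j hj => (hu.continuousOn_flux haα hαb (by omega) (by omega)).mono (hsub i hi))
      (fun j hj t ht => hu.hasDerivWithinAt_flux haα hαb (by omega) (hico ht))
      (fun t ht => by
        simp only [w]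
        rw [abs_mul, abs_of_pos (hβ0 t)]
        exact mul_le_mul (betaPW_le_max βm βp α t)
          (hu.abs_brokenDeriv_le haα hαb (by omega) (hsub i hi ht)) (abs_nonneg _) hBpos.le)
    rw [show 2 * p - 1 + 1 = 2 * p by omega] at hP
    have hw0 : ContinuousOn (w 0) (Icc (x (i - 1)) (x i)) :=
      (hu.continuousOn_flux haα hαb (by omega) (by omega)).mono (hsub i hi)
    have hPM : ∀ t ∈ Icc (x (i - 1)) (x i), |w 0 t - P.eval t| ≤ B * M * hm ^ (2 * p) :=
      fun t ht => (hP t ht).trans (by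
        have := hh i hi
        have := sub_nonneg.2 hle
        gcongr)
    have key := abs_integral_sub_le_of_quadrature (E := ε 1 1) hle hb₀pos
      (min_le_betaPW βm βp α) (hβi _ _)
      (fun j hj => ⟨(hg i hi j hj).1.le, (hg i hi j hj).2.1.le⟩) (hA i hi) (hquad i hi) hw0 hPdeg
      (hQdeg.trans (by omega)) hPM (fun j hj => by
        rw [← hconst i hi j hj, ← hQd _ ⟨(hg i hi j hj).1, (hg i hi j hj).2.1⟩ (hg i hi j hj).2.2]
        simp only [ε, w]
        rw [hu.deriv_eq (by omega) (hgα i hi j hj), mul_sub])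
    have hFTC : ∀ {v r : ℝ → ℝ}, ContinuousOn v (Icc a b) →
        ContinuousOn r (Icc (x (i - 1)) (x i)) →
        (∀ t ∈ Ico (x (i - 1)) (x i),
          HasDerivWithinAt v (r t / betaPW βm βp α t) (Ici t) t) →
        ∫ t in (x (i - 1))..(x i), r t / betaPW βm βp α t = v (x i) - v (x (i - 1)) := by
      intro v r hv hr hvr
      refine intervalIntegral.integral_eq_sub_of_hasDeriv_right_of_le hle (hv.mono (hsub i hi))
        (fun t ht => (hvr t (Ioo_subset_Ico_self ht)).mono Ioi_subset_Ici_self) ?_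
      simp only [div_eq_mul_inv]
      exact (hβi _ _).continuousOn_mul (by rwa [uIcc_of_le hle])
    rw [hFTC huT.1 Q.continuous.continuousOn hQr, hFTC hu.1 hw0 fun t ht => by
      have h := hu.hasDerivWithinAt_brokenDeriv haα hαb (j := 0) (by omega) (hico ht)
      rw [brokenDeriv_zero] at h
      convert h using 1
      exact mul_div_cancel_left₀ _ (hβ0 t).ne'] at key
    rw [hK]
    convert key using 2
    ring
  have hK0 : 0 ≤ K := by positivity
  obtain ⟨hE, hnode, hdiff⟩ := nodal_bounds_of_increments (e := fun i => u (x i) - uT (x i))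
    hb₀pos (min_le_betaPW βm βp α) (betaPW_le_max βm βp α) hβi hK0 hx (by rwa [hx0, hxN])
    (by simp [hx0, hu.2.1, huT.2.1]) (by simp [hxN, hu.2.2.1, huT.2.2.1]) hinc
  have hle : ∀ {s s' : ℝ}, 0 ≤ s' → s ≤ B + (1 + B * b₀⁻¹) * (d + 1) →
      K * s * s' ≤ 2 * B * b₀⁻¹ * (B + (1 + B * b₀⁻¹) * (d + 1)) * (hm ^ (2 * p) * s') * M := by
    intro s s' hs' hs
    calc K * s * s' ≤ K * (B + (1 + B * b₀⁻¹) * (d + 1)) * s' := by gcongr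
      _ = _ := by rw [hK]; ring
  have hone : 0 ≤ 1 + B * b₀⁻¹ := by positivity
  refine ⟨fun i hi j hj => ?_, fun i hi => ?_, fun i hi => ?_⟩
  · have h := hle (s := B) zero_le_one (by
      have : 0 ≤ (1 + B * b₀⁻¹) * (d + 1) := by positivity
      linarith)
    rw [mul_one, mul_one] at h
    exact ((congrArg abs (hconst i hi j hj)).trans_le hE).trans h
  · have h := hle (s := (1 + B * b₀⁻¹) * d) zero_le_one (by linarith)
    rw [mul_one, mul_one, ← mul_assoc] at h
    have h1 := hnode i hi
    rw [hx0, hxN, hd'] at h1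
    exact h1.trans h
  · have h := hle (s := 1 + B * b₀⁻¹) hhm (by
      have : 0 ≤ (1 + B * b₀⁻¹) * d := by positivity
      linarith)
    rw [← pow_succ] at h
    have h1 := hdiff i (Finset.mem_Icc.1 hi).1 (Finset.mem_Icc.1 hi).2
    exact (h1.trans (mul_le_mul_of_nonneg_left (hh i hi) (by positivity))).trans h
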